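/- Let U ⊆ ℂ be open, let φ₁, φ₃ : U → ℂ be holomorphic with primitives h₁, h₃, and define x(u+iv) = (Re h₁, −Im h₁, Re h₃). Then at every z₀ ∈ U with φ₁(z₀) ≠ 0, the isotropic mean curvature H = (g₁₁h₂₂ − 2g₁₂h₁₂ + g₂₂h₁₁)/(2(g₁₁g₂₂ − g₁₂²)) vanishes. That is, every Weierstrass map built from a holomorphic curve φ = (φ₁, iφ₁, φ₃) is a simply isotropic minimal immersion at all of its regular points. -/

import Mathlib

noncomputable section

/-- Partial derivative of a map on ℂ ≅ ℝ² in the u-direction (real direction 1). -/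
def du {E : Type*} [NormedAddCommGroup E] [NormedSpace ℝ E]
    (f : ℂ → E) : ℂ → E := fun z => fderiv ℝ f z 1

/-- Partial derivative of a map on ℂ ≅ ℝ² in the v-direction (direction i). -/
def dv {E : Type*} [NormedAddCommGroup E] [NormedSpace ℝ E]
    (f : ℂ → E) : ℂ → E := fun z => fderiv ℝ f z Complex.I

/-- The degenerate simply isotropic inner product on ℝ³: ⟨u,v⟩ = u₁v₁ + u₂v₂. -/
def isoInner (a b : ℝ × ℝ × ℝ) : ℝ := a.1 * b.1 + a.2.1 * b.2.1

/-- The Euclidean dot product on ℝ³. -/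
def dot3 (a b : ℝ × ℝ × ℝ) : ℝ := a.1 * b.1 + a.2.1 * b.2.1 + a.2.2 * b.2.2

/-- The Euclidean cross product on ℝ³. -/
def cross3 (a b : ℝ × ℝ × ℝ) : ℝ × ℝ × ℝ :=
  (a.2.1 * b.2.2 - a.2.2 * b.2.1, a.2.2 * b.1 - a.1 * b.2.2, a.1 * b.2.1 - a.2.1 * b.1)

/-- First fundamental form coefficients (isotropic metric) of x : ℂ → ℝ³. -/
def g11 (x : ℂ → ℝ × ℝ × ℝ) (z : ℂ) : ℝ := isoInner (du x z) (du x z)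
def g12 (x : ℂ → ℝ × ℝ × ℝ) (z : ℂ) : ℝ := isoInner (du x z) (dv x z)
def g22 (x : ℂ → ℝ × ℝ × ℝ) (z : ℂ) : ℝ := isoInner (dv x z) (dv x z)

/-- The minimal normal: the unique vector of the form (n₁,n₂,1) Euclidean-orthogonal to
x_u and x_v (obtained by normalizing the cross product so its third component is 1). -/
def Nm (x : ℂ → ℝ × ℝ × ℝ) (z : ℂ) : ℝ × ℝ × ℝ :=
  ((cross3 (du x z) (dv x z)).1 / (cross3 (du x z) (dv x z)).2.2,
   (cross3 (du x z) (dv x z)).2.1 / (cross3 (du x z) (dv x z)).2.2, 1)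

/-- Second fundamental form coefficients with respect to the minimal normal. -/
def h11 (x : ℂ → ℝ × ℝ × ℝ) (z : ℂ) : ℝ := dot3 (du (du x) z) (Nm x z)
def h12 (x : ℂ → ℝ × ℝ × ℝ) (z : ℂ) : ℝ := dot3 (du (dv x) z) (Nm x z)
def h22 (x : ℂ → ℝ × ℝ × ℝ) (z : ℂ) : ℝ := dot3 (dv (dv x) z) (Nm x z)

/-- The isotropic Gaussian curvature. -/
def Kcurv (x : ℂ → ℝ × ℝ × ℝ) (z : ℂ) : ℝ :=
  (h11 x z * h22 x z - (h12 x z) ^ 2) / (g11 x z * g22 x z - (g12 x z) ^ 2)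

/-- The isotropic mean curvature. -/
def meanH (x : ℂ → ℝ × ℝ × ℝ) (z : ℂ) : ℝ :=
  (g11 x z * h22 x z - 2 * g12 x z * h12 x z + g22 x z * h11 x z) /
    (2 * (g11 x z * g22 x z - (g12 x z) ^ 2))

theorem weier_fderiv (f g : ℂ → ℂ) (a b z : ℂ) (hf : HasDerivAt f a z) (hg : HasDerivAt g b z)
    (t : ℂ) :
    fderiv ℝ (fun w => ((f w).re, -(f w).im, (g w).re)) z t =
      ((t * a).re, -(t * a).im, (t * b).re) := by
  have hf' := hf.hasFDerivAt.restrictScalars ℝ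
  have hg' := hg.hasFDerivAt.restrictScalars ℝ
  have h1 := Complex.reCLM.hasFDerivAt.comp z hf'
  have h2 := (Complex.imCLM.hasFDerivAt.comp z hf').neg
  have h3 := Complex.reCLM.hasFDerivAt.comp z hg'
  have h := h1.prodMk (h2.prodMk h3)
  have e := h.fderiv
  have e' := congrArg (fun L => L t) e
  refine Eq.trans e' ?_
  simp

theorem weier_second (U : Set ℂ) (hU : IsOpen U) (f g p q : ℂ → ℂ)
    (hp : DifferentiableOn ℂ p U) (hq : DifferentiableOn ℂ q U)
    (hf : ∀ z ∈ U, HasDerivAt f (p z) z) (hg : ∀ z ∈ U, HasDerivAt g (q z) z)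
    (z : ℂ) (hz : z ∈ U) (s t : ℂ) :
    fderiv ℝ (fun y => fderiv ℝ (fun w => ((f w).re, -(f w).im, (g w).re)) y t) z s =
      ((s * (t * deriv p z)).re, -(s * (t * deriv p z)).im, (s * (t * deriv q z)).re) := by
  have hp' := ((hp.differentiableAt (hU.mem_nhds hz)).hasDerivAt).const_mul t
  have hq' := ((hq.differentiableAt (hU.mem_nhds hz)).hasDerivAt).const_mul t
  rw [← weier_fderiv _ _ _ _ z hp' hq' s]
  have : (fun y => fderiv ℝ (fun w => ((f w).re, -(f w).im, (g w).re)) y t) =ᶠ[nhds z]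
      (fun y => ((t * p y).re, -(t * p y).im, (t * q y).re)) := by
    filter_upwards [hU.mem_nhds hz] with y hy
    exact weier_fderiv f g _ _ y (hf y hy) (hg y hy) t
  rw [this.fderiv_eq]

/-- Every Weierstrass map x = (Re h₁, −Im h₁, Re h₃) built from a holomorphic curve
φ = (φ₁, iφ₁, φ₃) has vanishing isotropic mean curvature at all of its regular points:
H(z₀) = 0 whenever φ₁(z₀) ≠ 0. -/
theorem stmt12 (U : Set ℂ) (hU : IsOpen U) (φ₁ φ₃ h₁ h₃ : ℂ → ℂ)
    (hφ₁ : DifferentiableOn ℂ φ₁ U) (hφ₃ : DifferentiableOn ℂ φ₃ U)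
    (hh₁ : ∀ z ∈ U, HasDerivAt h₁ (φ₁ z) z)
    (hh₃ : ∀ z ∈ U, HasDerivAt h₃ (φ₃ z) z) :
    ∀ z₀ ∈ U, φ₁ z₀ ≠ 0 →
      meanH (fun w => ((h₁ w).re, -(h₁ w).im, (h₃ w).re)) z₀ = 0 := by
  intro z hz _
  have d := fun t => weier_fderiv h₁ h₃ _ _ z (hh₁ z hz) (hh₃ z hz) t
  have dd := weier_second U hU h₁ h₃ φ₁ φ₃ hφ₁ hφ₃ hh₁ hh₃ z hz
  have e1 : g11 (fun w => ((h₁ w).re, -(h₁ w).im, (h₃ w).re)) z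
      = g22 (fun w => ((h₁ w).re, -(h₁ w).im, (h₃ w).re)) z := by
    simp only [g11, g22, isoInner, du, dv, d]
    simp
    ring
  have e2 : g12 (fun w => ((h₁ w).re, -(h₁ w).im, (h₃ w).re)) z = 0 := by
    simp only [g12, isoInner, du, dv, d]
    simp
    ring
  have e3 : h22 (fun w => ((h₁ w).re, -(h₁ w).im, (h₃ w).re)) z
      = - h11 (fun w => ((h₁ w).re, -(h₁ w).im, (h₃ w).re)) z := by
    unfold h11 h22
    generalize Nm _ z = N
    unfold du dv
    rw [dd, dd]
    simp [dot3]
    ring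
  unfold meanH
  rw [e1, e2, e3]
  ring
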